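/- For letters x₁,…,x_k ∈ 𝒯ₙ, a letter t = t_{i,j} ∈ 𝒯ₙ, a word w ∈ 𝒯ₙ*, exponents l₁,…,l_k ≥ 0 and scalars a₁,…,a_k in a subring of H(V): (1) α_ς^z((x₁^{l₁}⧢⋯⧢x_k^{l_k})·t·w) = ∫_ς^z ω_{i,j}(s) · (∏_{p=1}^k (α_ς^z(x_p) − α_ς^s(x_p))^{l_p}/l_p!) · α_ς^s(w); (2) α_ς^z((a₁x₁+⋯+a_kx_k)^*·t·w) = ∫_ς^z ω_{i,j}(s) · (∏_{p=1}^k e^{a_p(α_ς^z(x_p) − α_ς^s(x_p))}) · α_ς^s(w), where P^* = Σ_{m≥0}P^m is the Kleene star and the integrals are along the path from ς to z. -/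

import Mathlib

/- STATEMENT 14: for letters x₁,…,x_k, a letter t, a word w and exponents l₁,…,l_k,
   (1) α_ς^z((x₁^{l₁}⧢⋯⧢x_k^{l_k})·t·w)
        = ∫_ς^z ω_t(s)·(∏_p (α_ς^z(x_p) − α_ς^s(x_p))^{l_p}/l_p!)·α_ς^s(w);
   (2) α_ς^z((a₁x₁+⋯+a_kx_k)^*·t·w)
        = ∫_ς^z ω_t(s)·(∏_p e^{a_p(α_ς^z(x_p) − α_ς^s(x_p))})·α_ς^s(w). -/

open scoped BigOperators

namespace NC

/-- The multiset of shuffles of two words. -/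
def shuffles {τ : Type*} : List τ → List τ → Multiset (List τ)
  | [], v => {v}
  | x :: u, [] => {x :: u}
  | x :: u, y :: v =>
      ((shuffles u (y :: v)).map (x :: ·)) + ((shuffles (x :: u) v).map (y :: ·))
  termination_by u v => u.length + v.length

/-- The multiset of shuffles of a list of words. -/
def shufflesList {τ : Type*} : List (List τ) → Multiset (List τ)
  | [] => {[]}
  | u :: rest => (shufflesList rest).bind fun v => shuffles u v

/-- Iterated integrals along a path (pulled back to the parameter interval). -/
noncomputable def iint {τ : Type*} (F : τ → ℝ → ℂ) : List τ → ℝ → ℂ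
  | [], _ => 1
  | x :: w, t => ∫ s in (0:ℝ)..t, F x s * iint F w s

end NC

open NC

namespace NC

open MeasureTheory Set

/-- Iterated integrals along a path with a variable base point. -/
noncomputable def basedIint {τ : Type*} (F : τ → ℝ → ℂ) (s : ℝ) : List τ → ℝ → ℂ
  | [], _ => 1
  | x :: w, t => ∫ r in s..t, F x r * basedIint F s w r

section

variable {τ : Type*} {F : τ → ℝ → ℂ}

theorem iint_eq_basedIint (u : List τ) (T : ℝ) : iint F u T = basedIint F 0 u T := by
  induction u generalizing T with
  | nil => rfl
  | cons x u ih => simp [iint, basedIint, ih]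

theorem basedIint_map {σ : Type*} (g : σ → τ) (s : ℝ) (u : List σ) (T : ℝ) :
    basedIint F s (u.map g) T = basedIint (fun y => F (g y)) s u T := by
  induction u generalizing T with
  | nil => rfl
  | cons x u ih => simp [basedIint, ih]

theorem iint_congr {G : τ → ℝ → ℂ} {T : ℝ} (h : ∀ x, ∀ r ∈ Ioo 0 T, F x r = G x r) (u : List τ)
    {t : ℝ} (ht₀ : 0 ≤ t) (ht : t ≤ T) : iint F u t = iint G u t := by
  induction u generalizing t with
  | nil => rfl
  | cons x u ih =>
    simp only [iint]
    refine intervalIntegral.integral_congr_Ioo_of_le ht₀ fun r hr => ?_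
    simp only [h x r ⟨hr.1, hr.2.trans_le ht⟩, ih hr.1.le (hr.2.le.trans ht)]

theorem continuous_basedIint_uncurry (hF : ∀ x, Continuous (F x)) (u : List τ) :
    Continuous fun p : ℝ × ℝ => basedIint F p.1 u p.2 := by
  induction u with
  | nil => exact continuous_const
  | cons x u ih =>
    have hi : Continuous (Function.uncurry fun (p : ℝ × ℝ) (r : ℝ) =>
        F x r * basedIint F p.1 u r) :=
      ((hF x).comp continuous_snd).mul
        (ih.comp ((continuous_fst.comp continuous_fst).prodMk continuous_snd))
    have hc (p : ℝ × ℝ) : Continuous fun r => F x r * basedIint F p.1 u r :=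
      hi.comp (Continuous.prodMk_right p)
    have h : (fun p : ℝ × ℝ => basedIint F p.1 (x :: u) p.2) = fun p : ℝ × ℝ =>
        (∫ r in (0:ℝ)..p.2, F x r * basedIint F p.1 u r) -
          ∫ r in (0:ℝ)..p.1, F x r * basedIint F p.1 u r := by
      funext p
      exact (intervalIntegral.integral_interval_sub_left
        ((hc p).intervalIntegrable _ _) ((hc p).intervalIntegrable _ _)).symm
    rw [h]
    exact (intervalIntegral.continuous_parametric_intervalIntegral_of_continuous hi
      continuous_snd).sub
      (intervalIntegral.continuous_parametric_intervalIntegral_of_continuous hi continuous_fst)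

theorem continuous_basedIint (hF : ∀ x, Continuous (F x)) (s : ℝ) (u : List τ) :
    Continuous (basedIint F s u) :=
  (continuous_basedIint_uncurry hF u).comp (Continuous.prodMk_right s)

theorem continuous_iint (hF : ∀ x, Continuous (F x)) (u : List τ) : Continuous (iint F u) := by
  rw [show iint F u = basedIint F 0 u from funext (iint_eq_basedIint u)]
  exact continuous_basedIint hF 0 u

theorem hasDerivAt_basedIint_cons (hF : ∀ x, Continuous (F x)) (s : ℝ) (x : τ) (u : List τ)
    (T : ℝ) : HasDerivAt (basedIint F s (x :: u)) (F x T * basedIint F s u T) T :=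
  ((hF x).mul (continuous_basedIint hF s u)).integral_hasStrictDerivAt s T |>.hasDerivAt

theorem basedIint_singleton (hF : ∀ x, Continuous (F x)) (x : τ) (s T : ℝ) :
    basedIint F s [x] T = iint F [x] T - iint F [x] s := by
  simp only [basedIint, iint, mul_one]
  exact (intervalIntegral.integral_interval_sub_left ((hF x).intervalIntegrable _ _)
    ((hF x).intervalIntegrable _ _)).symm

theorem integral_integral_triangle {f : ℝ → ℝ → ℂ} (hf : Continuous (Function.uncurry f)) {T : ℝ}
    (hT : 0 ≤ T) :
    ∫ r in (0:ℝ)..T, ∫ s in (0:ℝ)..r, f r s = ∫ s in (0:ℝ)..T, ∫ r in s..T, f r s := by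
  have hS : MeasurableSet {p : ℝ × ℝ | p.2 ≤ p.1} := measurableSet_le measurable_snd measurable_fst
  have key := intervalIntegral_intervalIntegral_swap (a := 0) (b := T) (c := 0) (d := T)
    (F := fun r s => {p : ℝ × ℝ | p.2 ≤ p.1}.indicator (Function.uncurry f) (r, s)) (by
      change IntegrableOn ({p : ℝ × ℝ | p.2 ≤ p.1}.indicator (Function.uncurry f)) _
      refine IntegrableOn.indicator ?_ hS
      rw [uIoc_of_le hT]
      exact (hf.continuousOn.integrableOn_compact (isCompact_Icc.prod isCompact_Icc)).mono_set
        (prod_mono Ioc_subset_Icc_self Ioc_subset_Icc_self))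
  have h₁ : ∫ r in (0:ℝ)..T, ∫ s in (0:ℝ)..T,
      {p : ℝ × ℝ | p.2 ≤ p.1}.indicator (Function.uncurry f) (r, s) =
      ∫ r in (0:ℝ)..T, ∫ s in (0:ℝ)..r, f r s := by
    refine intervalIntegral.integral_congr fun r hr => ?_
    rw [uIcc_of_le hT] at hr
    exact intervalIntegral.integral_indicator (f := f r) hr
  have h₂ : ∫ s in (0:ℝ)..T, ∫ r in (0:ℝ)..T,
      {p : ℝ × ℝ | p.2 ≤ p.1}.indicator (Function.uncurry f) (r, s) =
      ∫ s in (0:ℝ)..T, ∫ r in s..T, f r s := by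
    refine intervalIntegral.integral_congr fun s hs => ?_
    rw [uIcc_of_le hT] at hs
    have hc : Continuous fun r => f r s := hf.comp (Continuous.prodMk_left s)
    have hi : ∀ a b : ℝ, IntervalIntegrable (fun r =>
        {p : ℝ × ℝ | p.2 ≤ p.1}.indicator (Function.uncurry f) (r, s)) volume a b := fun a b => by
      have h := (hc.intervalIntegrable (μ := volume) a b).def'.indicator (measurableSet_Ici (a := s))
      exact intervalIntegrable_iff.2 h
    change ∫ r in (0:ℝ)..T, _ = _
    rw [← intervalIntegral.integral_add_adjacent_intervals (hi 0 s) (hi s T)]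
    have e₁ : ∫ r in (0:ℝ)..s, {p : ℝ × ℝ | p.2 ≤ p.1}.indicator (Function.uncurry f) (r, s) =
        ∫ r in (0:ℝ)..s, 0 := by
      refine intervalIntegral.integral_congr_Ioo_of_le hs.1 fun r hr => ?_
      have h : (r, s) ∉ {p : ℝ × ℝ | p.2 ≤ p.1} := not_le.2 hr.2
      exact indicator_of_notMem h _
    have e₂ : ∫ r in s..T, {p : ℝ × ℝ | p.2 ≤ p.1}.indicator (Function.uncurry f) (r, s) =
        ∫ r in s..T, f r s := by
      refine intervalIntegral.integral_congr_Ioo_of_le hs.2 fun r hr => ?_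
      have h : (r, s) ∈ {p : ℝ × ℝ | p.2 ≤ p.1} := hr.1.le
      exact indicator_of_mem h (Function.uncurry f)
    rw [e₁, e₂, intervalIntegral.integral_zero, zero_add]
  rw [← h₁, ← h₂, key]

/-- Splitting an iterated integral at an inner letter. -/
theorem iint_append_cons (hF : ∀ x, Continuous (F x)) (u : List τ) (t : τ) (w : List τ) {T : ℝ}
    (hT : 0 ≤ T) :
    iint F (u ++ t :: w) T = ∫ s in (0:ℝ)..T, F t s * basedIint F s u T * iint F w s := by
  induction u generalizing T with
  | nil => simp [iint, basedIint]
  | cons x u ih =>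
    have hc : Continuous (Function.uncurry fun r s =>
        F x r * (F t s * basedIint F s u r * iint F w s)) :=
      ((hF x).comp continuous_fst).mul ((((hF t).comp continuous_snd).mul
        ((continuous_basedIint_uncurry hF u).comp continuous_swap)).mul
        ((continuous_iint hF w).comp continuous_snd))
    calc iint F (x :: (u ++ t :: w)) T
        = ∫ r in (0:ℝ)..T, ∫ s in (0:ℝ)..r,
            F x r * (F t s * basedIint F s u r * iint F w s) := by
          refine intervalIntegral.integral_congr fun r hr => ?_
          rw [uIcc_of_le hT] at hr
          simp only [ih hr.1, intervalIntegral.integral_const_mul]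
      _ = ∫ s in (0:ℝ)..T, ∫ r in s..T,
            F x r * (F t s * basedIint F s u r * iint F w s) := integral_integral_triangle hc hT
      _ = _ := by
          refine intervalIntegral.integral_congr fun s _ => ?_
          simp only [basedIint]
          rw [← intervalIntegral.integral_const_mul, ← intervalIntegral.integral_mul_const]
          refine intervalIntegral.integral_congr fun r _ => ?_
          ring

theorem continuous_sum_basedIint (hF : ∀ x, Continuous (F x)) (m : Multiset (List τ)) (s : ℝ) :
    Continuous fun T => (m.map fun u => basedIint F s u T).sum :=
  continuous_multiset_sum m fun u _ => continuous_basedIint hF s u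

theorem sum_basedIint_cons (hF : ∀ x, Continuous (F x)) (m : Multiset (List τ)) (x : τ)
    (s T : ℝ) :
    (m.map fun u => basedIint F s (x :: u) T).sum =
      ∫ r in s..T, F x r * (m.map fun u => basedIint F s u r).sum := by
  induction m using Multiset.induction with
  | empty => simp
  | cons u m ih =>
    simp only [Multiset.map_cons, Multiset.sum_cons, ih, mul_add]
    rw [intervalIntegral.integral_add]
    · rfl
    · exact ((hF x).mul (continuous_basedIint hF s u)).intervalIntegrable _ _
    · exact ((hF x).mul (continuous_sum_basedIint hF m s)).intervalIntegrable _ _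

theorem sum_basedIint_shuffles (hF : ∀ x, Continuous (F x)) (u v : List τ) (s T : ℝ) :
    ((shuffles u v).map fun q => basedIint F s q T).sum =
      basedIint F s u T * basedIint F s v T := by
  induction u, v using shuffles.induct generalizing T with
  | case1 v => simp [shuffles, basedIint]
  | case2 x u => simp [shuffles, basedIint]
  | case3 x u y v ih₁ ih₂ =>
    rw [shuffles, Multiset.map_add, Multiset.sum_add, Multiset.map_map, Multiset.map_map]
    simp only [Function.comp_def]
    rw [sum_basedIint_cons hF, sum_basedIint_cons hF]
    simp only [ih₁, ih₂]
    have c (u) := continuous_basedIint hF s u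
    have h₁ : Continuous fun r => F x r * (basedIint F s u r * basedIint F s (y :: v) r) :=
      (hF x).mul ((c u).mul (c _))
    have h₂ : Continuous fun r => F y r * (basedIint F s (x :: u) r * basedIint F s v r) :=
      (hF y).mul ((c _).mul (c v))
    rw [← intervalIntegral.integral_add (h₁.intervalIntegrable _ _) (h₂.intervalIntegrable _ _),
      intervalIntegral.integral_eq_sub_of_hasDerivAt
        (f := fun r => basedIint F s (x :: u) r * basedIint F s (y :: v) r)]
    · simp [basedIint]
    · intro r _
      refine ((hasDerivAt_basedIint_cons hF s x u r).mul
        (hasDerivAt_basedIint_cons hF s y v r)).congr_deriv ?_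
      ring
    · exact (h₁.add h₂).intervalIntegrable _ _

theorem sum_basedIint_shufflesList (hF : ∀ x, Continuous (F x)) (L : List (List τ)) (s T : ℝ) :
    ((shufflesList L).map fun q => basedIint F s q T).sum =
      (L.map fun u => basedIint F s u T).prod := by
  induction L with
  | nil => simp [shufflesList, basedIint]
  | cons u L ih =>
    rw [shufflesList, Multiset.map_bind, Multiset.sum_bind]
    simp only [sum_basedIint_shuffles hF]
    rw [Multiset.sum_map_mul_left, ih, List.map_cons, List.prod_cons]

theorem integral_mul_integral_pow {f : ℝ → ℂ} (hf : Continuous f) (n : ℕ) (s T : ℝ) :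
    ∫ r in s..T, f r * ((∫ q in s..r, f q) ^ n / (n.factorial : ℂ)) =
      (∫ q in s..T, f q) ^ (n + 1) / ((n + 1).factorial : ℂ) := by
  have hd (r : ℝ) : HasDerivAt (fun r => ∫ q in s..r, f q) (f r) r :=
    (hf.integral_hasStrictDerivAt s r).hasDerivAt
  have hc : Continuous fun r => ∫ q in s..r, f q :=
    continuous_iff_continuousAt.2 fun r => (hd r).continuousAt
  rw [intervalIntegral.integral_eq_sub_of_hasDerivAt
    (f := fun r => (∫ q in s..r, f q) ^ (n + 1) / ((n + 1).factorial : ℂ))]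
  · simp
  · intro r _
    refine (((hd r).pow (n + 1)).div_const _).congr_deriv ?_
    have h₁ : ((n + 1 : ℕ) : ℂ) ≠ 0 := Nat.cast_ne_zero.2 n.succ_ne_zero
    have h₂ : (n.factorial : ℂ) ≠ 0 := Nat.cast_ne_zero.2 n.factorial_ne_zero
    rw [Nat.factorial_succ, Nat.cast_mul, Nat.add_sub_cancel]
    field_simp
  · exact (hf.mul ((hc.pow n).div_const _)).intervalIntegrable _ _

theorem basedIint_replicate (hF : ∀ x, Continuous (F x)) (n : ℕ) (x : τ) (s T : ℝ) :
    basedIint F s (List.replicate n x) T =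
      (∫ r in s..T, F x r) ^ n / (n.factorial : ℂ) := by
  induction n generalizing T with
  | zero => simp [basedIint]
  | succ n ih =>
    rw [← integral_mul_integral_pow (hF x), List.replicate_succ]
    simp only [basedIint, ih]

theorem norm_basedIint_le {M : ℝ} {s T : ℝ}
    (hM : ∀ x, ∀ r ∈ Icc s T, ‖F x r‖ ≤ M) (u : List τ) {t : ℝ} (hst : s ≤ t) (htT : t ≤ T) :
    ‖basedIint F s u t‖ ≤ (M * (t - s)) ^ u.length / (u.length.factorial : ℝ) := by
  induction u generalizing t with
  | nil => simp [basedIint]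
  | cons x u ih =>
    have hint : ∫ r in s..t, M * ((M * (r - s)) ^ u.length / (u.length.factorial : ℝ)) =
        (M * (t - s)) ^ (u.length + 1) / ((u.length + 1).factorial : ℝ) := by
      simp only [mul_pow, mul_div_assoc]
      rw [intervalIntegral.integral_const_mul, intervalIntegral.integral_const_mul,
        intervalIntegral.integral_div,
        intervalIntegral.integral_comp_sub_right (fun r => r ^ u.length) s, integral_pow,
        Nat.factorial_succ]
      have h₂ : (u.length.factorial : ℝ) ≠ 0 := Nat.cast_ne_zero.2 u.length.factorial_ne_zero
      push_cast
      field_simp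
      simp
      ring
    rw [List.length_cons, ← hint]
    refine intervalIntegral.norm_integral_le_of_norm_le hst ?_
      (Continuous.intervalIntegrable (by fun_prop) _ _)
    refine Filter.Eventually.of_forall fun r hr => ?_
    rw [norm_mul]
    have h := hM x r ⟨hr.1.le, hr.2.trans htT⟩
    exact mul_le_mul h (ih hr.1.le (hr.2.trans htT)) (norm_nonneg _) ((norm_nonneg _).trans h)

end

section KleeneStar

variable {σ : Type*} [Fintype σ] {F : σ → ℝ → ℂ}

theorem sum_ofFn_basedIint (hF : ∀ x, Continuous (F x)) (c : σ → ℂ) (n : ℕ) (s T : ℝ) :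
    ∑ v : Fin n → σ, ((List.ofFn v).map c).prod * basedIint F s (List.ofFn v) T =
      (∫ r in s..T, ∑ y, c y * F y r) ^ n / (n.factorial : ℂ) := by
  induction n generalizing T with
  | zero => simp [basedIint]
  | succ n ih =>
    rw [← integral_mul_integral_pow (by fun_prop), ← (Fin.consEquiv fun _ => σ).sum_comp,
      Fintype.sum_prod_type]
    simp only [← ih, Finset.sum_mul_sum]
    have hc (v : List σ) := continuous_basedIint hF s v
    rw [intervalIntegral.integral_finsetSum
      (fun y _ => Continuous.intervalIntegrable (by fun_prop) _ _)]
    refine Finset.sum_congr rfl fun y _ => ?_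
    rw [intervalIntegral.integral_finsetSum
      (fun y _ => Continuous.intervalIntegrable (by fun_prop) _ _)]
    refine Finset.sum_congr rfl fun v _ => ?_
    simp only [Fin.consEquiv, Equiv.coe_fn_mk, List.ofFn_cons, List.map_cons, List.prod_cons,
      basedIint]
    rw [← intervalIntegral.integral_const_mul]
    refine intervalIntegral.integral_congr fun r _ => ?_
    ring

theorem summable_list_prod_mul_pow_div_factorial {d : σ → ℝ} (hd : ∀ y, 0 ≤ d y) {M : ℝ}
    (hM : 0 ≤ M) :
    Summable fun u : List σ => (u.map d).prod * (M ^ u.length / (u.length.factorial : ℝ)) := by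
  rw [← List.equivSigmaTuple.symm.summable_iff]
  refine (summable_sigma_of_nonneg fun p => ?_).2 ⟨fun n => Summable.of_finite, ?_⟩
  · exact mul_nonneg (List.prod_nonneg (by simp [hd])) (by positivity)
  · refine (Real.summable_pow_div_factorial ((∑ y, d y) * M)).congr fun n => ?_
    rw [tsum_fintype, mul_pow, Fintype.sum_pow, Finset.sum_mul, Finset.sum_div]
    refine Finset.sum_congr rfl fun v _ => ?_
    simp [List.equivSigmaTuple, List.map_ofFn, List.prod_ofFn, mul_div_assoc]

theorem hasSum_basedIint (hF : ∀ x, Continuous (F x)) (c : σ → ℂ) (s T : ℝ)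
    (hs : Summable fun u : List σ => (u.map c).prod * basedIint F s u T) :
    HasSum (fun u : List σ => (u.map c).prod * basedIint F s u T)
      (Complex.exp (∫ r in s..T, ∑ y, c y * F y r)) := by
  rw [← List.equivSigmaTuple.symm.hasSum_iff]
  refine HasSum.sigma_of_hasSum
    (g := fun n => (∫ r in s..T, ∑ y, c y * F y r) ^ n / (n.factorial : ℂ)) ?_ (fun n => ?_)
    (List.equivSigmaTuple.symm.summable_iff.2 hs)
  · rw [Complex.exp_eq_exp_ℂ]
    exact NormedSpace.expSeries_div_hasSum_exp _
  · rw [← sum_ofFn_basedIint hF]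
    exact hasSum_fintype _

theorem hasSum_integral_basedIint (hF : ∀ x, Continuous (F x)) (c : σ → ℂ) {f g : ℝ → ℂ}
    (hf : Continuous f) (hg : Continuous g) :
    HasSum (fun u : List σ => (u.map c).prod *
        ∫ s in (0:ℝ)..1, f s * basedIint F s u 1 * g s)
      (∫ s in (0:ℝ)..1, f s * Complex.exp (∫ r in s..1, ∑ y, c y * F y r) * g s) := by
  obtain ⟨M, hM⟩ : ∃ M : ℝ, ∀ y, ∀ r ∈ Icc (0:ℝ) 1, ‖F y r‖ ≤ M := by
    choose M hM using fun y => isCompact_Icc.exists_bound_of_continuousOn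
      ((hF y).continuousOn (s := Icc (0:ℝ) 1))
    exact ⟨∑ y, |M y|, fun y r hr => (hM y r hr).trans <| (le_abs_self _).trans <|
      Finset.single_le_sum (f := fun y => |M y|) (fun _ _ => abs_nonneg _) (Finset.mem_univ y)⟩
  obtain ⟨K, hK⟩ := isCompact_Icc.exists_bound_of_continuousOn
    ((hf.mul hg).continuousOn (s := Icc (0:ℝ) 1))
  have hM' : ∀ y, ∀ r ∈ Icc (0:ℝ) 1, ‖F y r‖ ≤ |M| := fun y r hr =>
    (hM y r hr).trans (le_abs_self M)
  have hsum := summable_list_prod_mul_pow_div_factorial (d := fun y => ‖c y‖)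
    (fun _ => norm_nonneg _) (abs_nonneg M)
  have hbound (u : List σ) {s : ℝ} (hs : s ∈ Icc (0:ℝ) 1) :
      ‖(u.map c).prod * basedIint F s u 1‖ ≤
        (u.map fun y => ‖c y‖).prod * (|M| ^ u.length / (u.length.factorial : ℝ)) := by
    rw [norm_mul, List.norm_prod, List.map_map]
    refine mul_le_mul_of_nonneg_left ?_ (List.prod_nonneg (by simp))
    refine (norm_basedIint_le (fun y r hr => hM' y r ⟨hs.1.trans hr.1, hr.2⟩) u hs.2
      le_rfl).trans ?_
    have := hs.1
    have := sub_nonneg.2 hs.2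
    gcongr
    exact mul_le_of_le_one_right (abs_nonneg M) (by linarith)
  simp only [← intervalIntegral.integral_const_mul]
  refine intervalIntegral.hasSum_integral_of_dominated_convergence
    (fun u _ => K * ((u.map fun y => ‖c y‖).prod *
      (|M| ^ u.length / (u.length.factorial : ℝ)))) (fun u => ?_) (fun u => ?_) ?_ ?_ ?_
  · have : Continuous fun s => basedIint F s u 1 :=
      (continuous_basedIint_uncurry hF u).comp (Continuous.prodMk_left 1)
    exact Continuous.aestronglyMeasurable (by fun_prop)
  · refine Filter.Eventually.of_forall fun s hs => ?_
    rw [uIoc_of_le zero_le_one] at hs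
    have hs' := Ioc_subset_Icc_self hs
    rw [show (u.map c).prod * (f s * basedIint F s u 1 * g s) =
      f s * g s * ((u.map c).prod * basedIint F s u 1) by ring, norm_mul]
    have h := hK s hs'
    exact mul_le_mul h (hbound u hs') (norm_nonneg _) ((norm_nonneg _).trans h)
  · exact Filter.Eventually.of_forall fun s _ => hsum.mul_left K
  · exact intervalIntegrable_const
  · refine Filter.Eventually.of_forall fun s hs => ?_
    rw [uIoc_of_le zero_le_one] at hs
    have h := ((hasSum_basedIint hF c s 1 (Summable.of_norm_bounded hsum fun u =>
      hbound u (Ioc_subset_Icc_self hs))).mul_left (f s)).mul_right (g s)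
    rw [show (fun u : List σ => (u.map c).prod * (f s * basedIint F s u 1 * g s)) =
      fun u => f s * ((u.map c).prod * basedIint F s u 1) * g s by funext u; ring]
    exact h

end KleeneStar

section

variable {τ : Type*} {F : τ → ℝ → ℂ} {k : ℕ}

theorem sum_iint_shufflesList_append_cons (hF : ∀ x, Continuous (F x)) (x : Fin k → τ)
    (l : Fin k → ℕ) (t : τ) (w : List τ) :
    ((shufflesList (List.ofFn fun p => List.replicate (l p) (x p))).map
        fun u => iint F (u ++ t :: w) 1).sum =
      ∫ s in (0:ℝ)..1, F t s *
        (∏ p : Fin k, (iint F [x p] 1 - iint F [x p] s) ^ (l p) / ((l p).factorial : ℂ)) *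
        iint F w s := by
  have hsum (m : Multiset (List τ)) : (m.map fun u => iint F (u ++ t :: w) 1).sum =
      ∫ s in (0:ℝ)..1, F t s * (m.map fun u => basedIint F s u 1).sum * iint F w s := by
    have hc (u : List τ) : Continuous fun s => basedIint F s u 1 :=
      (continuous_basedIint_uncurry hF u).comp (Continuous.prodMk_left 1)
    have hw := continuous_iint hF w
    have ht := hF t
    induction m using Multiset.induction with
    | empty => simp
    | cons u m ih =>
      have hm : Continuous fun s => (m.map fun u => basedIint F s u 1).sum :=
        continuous_multiset_sum m fun u _ => hc u
      have hu := hc u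
      have h₁ : Continuous fun s => F t s * basedIint F s u 1 * iint F w s := (ht.mul hu).mul hw
      have h₂ : Continuous fun s =>
          F t s * (m.map fun u => basedIint F s u 1).sum * iint F w s := (ht.mul hm).mul hw
      rw [Multiset.map_cons, Multiset.sum_cons, ih, iint_append_cons hF _ _ _ zero_le_one,
        ← intervalIntegral.integral_add (h₁.intervalIntegrable _ _) (h₂.intervalIntegrable _ _)]
      simp only [Multiset.map_cons, Multiset.sum_cons, mul_add, add_mul]
  rw [hsum]
  refine intervalIntegral.integral_congr fun s _ => ?_
  simp only [sum_basedIint_shufflesList hF, List.map_ofFn, List.prod_ofFn, Function.comp_def,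
    basedIint_replicate hF, ← basedIint_singleton hF, basedIint, mul_one]

theorem tsum_iint_append_cons [DecidableEq τ] (hF : ∀ x, Continuous (F x)) (x : Fin k → τ)
    (a : Fin k → ℂ) (t : τ) (w : List τ) :
    (∑' u : List τ,
        (u.map fun y => ∑ p ∈ Finset.univ.filter fun p => x p = y, a p).prod *
          iint F (u ++ t :: w) 1) =
      ∫ s in (0:ℝ)..1, F t s *
        (∏ p : Fin k, Complex.exp (a p * (iint F [x p] 1 - iint F [x p] s))) *
        iint F w s := by
  let S : Finset τ := Finset.univ.image x
  let c : τ → ℂ := fun y => ∑ p ∈ Finset.univ.filter fun p => x p = y, a p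
  have hc (y : τ) (hy : y ∉ S) : c y = 0 := by
    refine Finset.sum_eq_zero fun p hp => (hy ?_).elim
    rw [← (Finset.mem_filter.1 hp).2]
    exact Finset.mem_image_of_mem _ (Finset.mem_univ p)
  have hsupp : Function.support (fun u : List τ => (u.map c).prod * iint F (u ++ t :: w) 1) ⊆
      range (List.map (Subtype.val : S → τ)) := by
    intro u hu
    rw [range_list_map]
    intro y hy
    by_contra h
    refine hu ?_
    have h0 : (u.map c).prod = 0 :=
      List.prod_eq_zero (List.mem_map.2 ⟨y, hy, hc y (by simpa using h)⟩)
    simp only [h0, zero_mul]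
  have hΦ (s : ℝ) : ∫ r in s..1, ∑ y : S, c y * F y r =
      ∑ p, a p * (iint F [x p] 1 - iint F [x p] s) := by
    have h (r : ℝ) : ∑ y : S, c y * F y r = ∑ p, a p * F (x p) r := by
      rw [Finset.sum_coe_sort S fun y => c y * F y r,
        ← Finset.sum_fiberwise_of_maps_to (g := x) (t := S)
          (fun p hp => Finset.mem_image_of_mem _ hp)]
      refine Finset.sum_congr rfl fun y _ => ?_
      rw [Finset.sum_mul]
      exact Finset.sum_congr rfl fun p hp => by rw [(Finset.mem_filter.1 hp).2]
    simp only [h]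
    rw [intervalIntegral.integral_finsetSum
      (fun p _ => Continuous.intervalIntegrable (by fun_prop) _ _)]
    simp only [intervalIntegral.integral_const_mul, ← basedIint_singleton hF, basedIint, mul_one]
  change ∑' u : List τ, (u.map c).prod * iint F (u ++ t :: w) 1 = _
  rw [← (List.map_injective_iff.2 Subtype.val_injective).tsum_eq hsupp]
  have h := hasSum_integral_basedIint (F := fun y : S => F y) (fun y => hF y) (fun y => c y)
    (hF t) (continuous_iint hF w)
  simp only [hΦ, Complex.exp_sum] at h
  rw [← h.tsum_eq]
  refine tsum_congr fun u => ?_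
  rw [iint_append_cons hF _ _ _ zero_le_one, List.map_map]
  simp only [basedIint_map, Function.comp_def]

end

end NC

theorem statement14
    {E : Type*} [NormedAddCommGroup E] [NormedSpace ℂ E]
    {τ : Type*} [DecidableEq τ]
    -- the simply connected complex domain and the holomorphic 1-forms ω indexed by 𝒯ₙ
    (V : Set E) (hV : IsOpen V) (ω : τ → E → (E →L[ℂ] ℂ))
    (hω : ∀ x, DifferentiableOn ℂ (ω x) V)
    -- a piecewise smooth path γ from ς to z inside V
    (γ : ℝ → E) (ς z : E) (hγ₀ : γ 0 = ς) (hγ₁ : γ 1 = z)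
    (hγV : ∀ u ∈ Set.Icc (0:ℝ) 1, γ u ∈ V)
    (hγC : ContDiffOn ℝ 1 γ (Set.Icc (0:ℝ) 1))
    -- the pullbacks of the 1-forms along γ
    (F : τ → ℝ → ℂ) (hF : ∀ x u, F x u = ω x (γ u) (deriv γ u))
    -- letters x₁,…,x_k, exponents l₁,…,l_k, scalars a₁,…,a_k, a letter t, a word w
    (k : ℕ) (x : Fin k → τ) (l : Fin k → ℕ) (a : Fin k → ℂ) (t : τ) (w : List τ) :
    -- (1)
    (((shufflesList (List.ofFn fun p => List.replicate (l p) (x p))).map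
        fun u => iint F (u ++ t :: w) 1).sum =
      ∫ s in (0:ℝ)..1, F t s *
        (∏ p : Fin k, (iint F [x p] 1 - iint F [x p] s) ^ (l p) / ((l p).factorial : ℂ)) *
        iint F w s) ∧
    -- (2), where the coefficient of (a₁x₁+⋯+a_kx_k)^* on a word u is the product of the
    -- coefficients of its letters
    ((∑' u : List τ,
        (u.map fun y => ∑ p ∈ Finset.univ.filter fun p => x p = y, a p).prod *
          iint F (u ++ t :: w) 1) =
      ∫ s in (0:ℝ)..1, F t s *
        (∏ p : Fin k, Complex.exp (a p * (iint F [x p] 1 - iint F [x p] s))) *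
        iint F w s) := by
  have hD : ContinuousOn (derivWithin γ (Set.Icc (0:ℝ) 1)) (Set.Icc (0:ℝ) 1) :=
    hγC.continuousOn_derivWithin (uniqueDiffOn_Icc zero_lt_one) le_rfl
  have hωγ (y : τ) : ContinuousOn (fun u => ω y (γ u)) (Set.Icc (0:ℝ) 1) :=
    (hω y).continuousOn.comp hγC.continuousOn hγV
  let G : τ → ℝ → ℂ := fun y => Set.IccExtend zero_le_one
    ((Set.Icc (0:ℝ) 1).domRestrict fun u => ω y (γ u) (derivWithin γ (Set.Icc (0:ℝ) 1) u))
  have hG (y : τ) : Continuous (G y) :=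
    (continuousOn_iff_continuous_domRestrict.1 ((hωγ y).clm_apply hD)).Icc_extend'
  have hFG (y : τ) (u : ℝ) (hu : u ∈ Set.Ioo (0:ℝ) 1) : F y u = G y u := by
    simp only [G]
    rw [hF, Set.IccExtend_of_mem _ _ (Set.Ioo_subset_Icc_self hu), Set.domRestrict_apply,
      derivWithin_of_mem_nhds (Icc_mem_nhds hu.1 hu.2)]
  have hI (u : List τ) {s : ℝ} (hs : s ∈ Set.Icc (0:ℝ) 1) : iint F u s = iint G u s :=
    iint_congr hFG u hs.1 hs.2
  have h1 (u : List τ) : iint F u 1 = iint G u 1 := hI u (Set.right_mem_Icc.2 zero_le_one)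
  constructor
  · simp only [h1]
    rw [sum_iint_shufflesList_append_cons hG]
    refine intervalIntegral.integral_congr_Ioo_of_le zero_le_one fun s hs => ?_
    simp only [hFG t s hs, hI _ (Set.Ioo_subset_Icc_self hs)]
  · simp only [h1]
    rw [tsum_iint_append_cons hG]
    refine intervalIntegral.integral_congr_Ioo_of_le zero_le_one fun s hs => ?_
    simp only [hFG t s hs, hI _ (Set.Ioo_subset_Icc_self hs)]
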